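/- Let f be a ternary cubic form over ℝ with Δ(f) ≠ 0. Then the stabilizer of f in GL₃⁺(ℝ), i.e., the set of γ ∈ GL₃(ℝ) with det(γ) > 0 and γ·f = f, has exactly 3 elements. -/

import Mathlib

open MvPolynomial

/-- The action of a 3×3 matrix on ternary forms: `(γ·f)(x,y,z) = f((x,y,z)·γ)`. -/
noncomputable def actGL {R : Type*} [CommRing R] (γ : Matrix (Fin 3) (Fin 3) R)
    (f : MvPolynomial (Fin 3) R) : MvPolynomial (Fin 3) R :=
  bind₁ (fun j => ∑ i : Fin 3, C (γ i j) * X i) f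

/-- The Hessian of a ternary form: the determinant of the matrix of second partials. -/
noncomputable def hess {R : Type*} [CommRing R] (f : MvPolynomial (Fin 3) R) :
    MvPolynomial (Fin 3) R :=
  Matrix.det (Matrix.of fun i j => pderiv i (pderiv j f))

/-- The exponent vectors of the ten monomials of a ternary cubic form. -/
def expo : Fin 10 → Fin 3 → ℕ :=
  ![![3,0,0], ![0,3,0], ![0,0,3], ![2,1,0], ![2,0,1],
    ![1,2,0], ![0,2,1], ![1,0,2], ![0,1,2], ![1,1,1]]

/-- The ternary cubic form with coefficient vector `c : Fin 10 → R`. -/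
noncomputable def cubic {R : Type*} [CommRing R] (c : Fin 10 → R) : MvPolynomial (Fin 3) R :=
  ∑ k : Fin 10, C (c k) * ∏ i : Fin 3, X i ^ expo k i

/-- The coefficient vector of the Weierstrass cubic `x³ + A·x·z² + B·z³ − y²·z`. -/
noncomputable def wcoeffs {R : Type*} [CommRing R] (A B : R) : Fin 10 → R :=
  ![1, 0, B, 0, 0, 0, -1, A, 0, 0]

/-- The generic ternary cubic form, whose coefficients are the 10 indeterminates. -/
noncomputable def genCubic (R : Type*) [CommRing R] :
    MvPolynomial (Fin 3) (MvPolynomial (Fin 10) R) :=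
  cubic (fun k => X k)

/-- `P` and `Q` are the invariants `I` and `J`: they are homogeneous of degrees 4 and 6
in the ten coefficients, they satisfy the identity
`H(H(f)) = 12288·I(f)²·f + 512·J(f)·H(f)` (stated for the generic ternary cubic form,
hence for every ternary cubic form over every commutative `R`-algebra), and they are
normalized so that `x³ + A·x·z² + B·z³ − y²·z` has `I = −3A` and `J = −27B`. -/
def IsInvariantPair (R : Type*) [CommRing R] (P Q : MvPolynomial (Fin 10) R) : Prop :=
  P.IsHomogeneous 4 ∧ Q.IsHomogeneous 6 ∧
  hess (hess (genCubic R)) =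
    12288 * C P ^ 2 * genCubic R + 512 * C Q * hess (genCubic R) ∧
  ∀ A B : R, aeval (wcoeffs A B) P = -3 * A ∧ aeval (wcoeffs A B) Q = -27 * B


/-! ### Basic facts -/

/-- Coefficient vector of the Hessian of a ternary cubic. -/
def hc {R : Type*} [CommRing R] (c : Fin 10 → R) : Fin 10 → R :=
  ![24*c 0*c 5*c 7 - 6*c 0*c 9^2 + 8*c 3*c 4*c 9 - 8*c 3^2*c 7 - 8*c 4^2*c 5,
    24*c 1*c 3*c 8 - 6*c 1*c 9^2 - 8*c 3*c 6^2 + 8*c 5*c 6*c 9 - 8*c 5^2*c 8,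
    24*c 2*c 4*c 6 - 6*c 2*c 9^2 - 8*c 4*c 8^2 - 8*c 6*c 7^2 + 8*c 7*c 8*c 9,
    72*c 0*c 1*c 7 + 24*c 0*c 5*c 8 - 24*c 0*c 6*c 9 - 24*c 1*c 4^2 + 16*c 3*c 4*c 6
      - 8*c 3*c 5*c 7 + 2*c 3*c 9^2 - 8*c 3^2*c 8,
    72*c 0*c 2*c 5 + 24*c 0*c 6*c 7 - 24*c 0*c 8*c 9 - 24*c 2*c 3^2 + 16*c 3*c 4*c 8
      - 8*c 4*c 5*c 7 + 2*c 4*c 9^2 - 8*c 4^2*c 6,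
    72*c 0*c 1*c 8 - 24*c 0*c 6^2 + 24*c 1*c 3*c 7 - 24*c 1*c 4*c 9 - 8*c 3*c 5*c 8
      + 16*c 4*c 5*c 6 + 2*c 5*c 9^2 - 8*c 5^2*c 7,
    72*c 1*c 2*c 3 + 24*c 1*c 4*c 8 - 24*c 1*c 7*c 9 - 24*c 2*c 5^2 - 8*c 3*c 6*c 8
      - 8*c 4*c 6^2 + 16*c 5*c 6*c 7 + 2*c 6*c 9^2,
    72*c 0*c 2*c 6 - 24*c 0*c 8^2 - 24*c 2*c 3*c 9 + 24*c 2*c 4*c 5 + 16*c 3*c 7*c 8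
      - 8*c 4*c 6*c 7 - 8*c 5*c 7^2 + 2*c 7*c 9^2,
    72*c 1*c 2*c 4 - 24*c 1*c 7^2 + 24*c 2*c 3*c 6 - 24*c 2*c 5*c 9 - 8*c 3*c 8^2
      - 8*c 4*c 6*c 8 + 16*c 5*c 7*c 8 + 2*c 8*c 9^2,
    216*c 0*c 1*c 2 - 24*c 0*c 6*c 8 - 24*c 1*c 4*c 7 - 24*c 2*c 3*c 5 + 24*c 3*c 6*c 7
      - 8*c 3*c 8*c 9 + 24*c 4*c 5*c 8 - 8*c 4*c 6*c 9 - 8*c 5*c 7*c 9 + 2*c 9^3]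

lemma cubic_expand {R : Type*} [CommRing R] (c : Fin 10 → R) :
    cubic c = C (c 0) * X 0 ^ 3 + C (c 1) * X 1 ^ 3 + C (c 2) * X 2 ^ 3
      + C (c 3) * (X 0 ^ 2 * X 1) + C (c 4) * (X 0 ^ 2 * X 2) + C (c 5) * (X 0 * X 1 ^ 2)
      + C (c 6) * (X 1 ^ 2 * X 2) + C (c 7) * (X 0 * X 2 ^ 2) + C (c 8) * (X 1 * X 2 ^ 2)
      + C (c 9) * (X 0 * X 1 * X 2) := by
  simp [cubic, Fin.sum_univ_succ, Fin.prod_univ_three, expo]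
  ring

set_option maxHeartbeats 1600000 in
lemma hess_cubic {R : Type*} [CommRing R] (c : Fin 10 → R) :
    hess (cubic c) = cubic (hc c) := by
  have h01 : pderiv (R := R) (0 : Fin 3) (X 1) = 0 := pderiv_X_of_ne (by decide)
  have h02 : pderiv (R := R) (0 : Fin 3) (X 2) = 0 := pderiv_X_of_ne (by decide)
  have h10 : pderiv (R := R) (1 : Fin 3) (X 0) = 0 := pderiv_X_of_ne (by decide)
  have h12 : pderiv (R := R) (1 : Fin 3) (X 2) = 0 := pderiv_X_of_ne (by decide)
  have h20 : pderiv (R := R) (2 : Fin 3) (X 0) = 0 := pderiv_X_of_ne (by decide)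
  have h21 : pderiv (R := R) (2 : Fin 3) (X 1) = 0 := pderiv_X_of_ne (by decide)
  rw [cubic_expand (hc c), cubic_expand c, hess, Matrix.det_fin_three]
  simp only [Matrix.of_apply, map_add, Derivation.leibniz, Derivation.leibniz_pow, pderiv_C,
    pderiv_X_self, h01, h02, h10, h12, h20, h21, smul_eq_mul, mul_zero, zero_mul, add_zero,
    zero_add, mul_one, nsmul_eq_mul, Derivation.map_natCast, map_zero]
  have e : ∀ n : ℕ, [n.AtLeastTwo] → (C (OfNat.ofNat n : R) : MvPolynomial (Fin 3) R)
    = OfNat.ofNat n := fun n _ => map_ofNat _ n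
  simp [hc, map_sub, map_mul, map_add, map_pow, e]
  ring

lemma cubic_add {R : Type*} [CommRing R] (c d : Fin 10 → R) :
    cubic (c + d) = cubic c + cubic d := by
  simp [cubic, add_mul, Finset.sum_add_distrib]

lemma cubic_smul {R : Type*} [CommRing R] (s : R) (c : Fin 10 → R) :
    cubic (s • c) = C s * cubic c := by
  simp [cubic, Finset.mul_sum, mul_assoc]

lemma eval_cubic {R : Type*} [CommRing R] (c : Fin 10 → R) (v : Fin 3 → R) :
    eval v (cubic c) = c 0 * v 0 ^ 3 + c 1 * v 1 ^ 3 + c 2 * v 2 ^ 3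
      + c 3 * (v 0 ^ 2 * v 1) + c 4 * (v 0 ^ 2 * v 2) + c 5 * (v 0 * v 1 ^ 2)
      + c 6 * (v 1 ^ 2 * v 2) + c 7 * (v 0 * v 2 ^ 2) + c 8 * (v 1 * v 2 ^ 2)
      + c 9 * (v 0 * v 1 * v 2) := by
  simp [cubic_expand]

lemma expo_inj (i j : Fin 10) : expo i = expo j → i = j := by
  revert i j; decide

lemma cubic_coeff {R : Type*} [CommRing R] (c : Fin 10 → R) (k : Fin 10) :
    coeff (Finsupp.equivFunOnFinite.symm (expo k)) (cubic c) = c k := by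
  have : ∀ j : Fin 10, (C (c j) * ∏ i : Fin 3, X i ^ expo j i : MvPolynomial (Fin 3) R)
      = monomial (Finsupp.equivFunOnFinite.symm (expo j)) (c j) := by
    intro j
    rw [monomial_eq, Finsupp.prod_fintype _ _ (by simp)]
    simp
  simp only [cubic, this, coeff_sum, coeff_monomial]
  rw [Finset.sum_eq_single k]
  · simp
  · intro b _ hb
    rw [if_neg]
    intro h
    exact hb (expo_inj _ _ (Finsupp.equivFunOnFinite.symm.injective h))
  · simp

lemma cubic_inj {R : Type*} [CommRing R] {c d : Fin 10 → R} (h : cubic c = cubic d) : c = d := by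
  funext k
  rw [← cubic_coeff c k, h, cubic_coeff]

lemma hess_smul {R : Type*} [CommRing R] (s : R) (f : MvPolynomial (Fin 3) R) :
    hess (C s * f) = C (s ^ 3) * hess f := by
  have : (Matrix.of fun i j => pderiv i (pderiv j (C s * f)))
      = (C s : MvPolynomial (Fin 3) R) • (Matrix.of fun i j => pderiv i (pderiv j f)) := by
    ext1 i j
    simp [Derivation.leibniz]
  rw [hess, this, Matrix.det_smul, hess]
  simp

/-! ### The action -/

lemma actGL_C_mul {R : Type*} [CommRing R] (γ : Matrix (Fin 3) (Fin 3) R) (s : R)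
    (f : MvPolynomial (Fin 3) R) : actGL γ (C s * f) = C s * actGL γ f := by
  simp [actGL]

lemma actGL_add {R : Type*} [CommRing R] (γ : Matrix (Fin 3) (Fin 3) R)
    (f g : MvPolynomial (Fin 3) R) : actGL γ (f + g) = actGL γ f + actGL γ g := by
  simp [actGL]

lemma actGL_actGL {R : Type*} [CommRing R] (γ δ : Matrix (Fin 3) (Fin 3) R)
    (f : MvPolynomial (Fin 3) R) : actGL γ (actGL δ f) = actGL (γ * δ) f := by
  unfold actGL
  rw [bind₁_bind₁]
  congr 2
  funext j
  simp [Matrix.mul_apply, Fin.sum_univ_three]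
  ring

lemma actGL_one {R : Type*} [CommRing R] (f : MvPolynomial (Fin 3) R) : actGL 1 f = f := by
  unfold actGL
  have : (fun j : Fin 3 => ∑ i : Fin 3, C ((1 : Matrix (Fin 3) (Fin 3) R) i j) * X i)
      = (X : Fin 3 → MvPolynomial (Fin 3) R) := by
    funext j
    simp [Matrix.one_apply]
  rw [this]
  simp

lemma eval_actGL {R : Type*} [CommRing R] (γ : Matrix (Fin 3) (Fin 3) R)
    (f : MvPolynomial (Fin 3) R) (v : Fin 3 → R) :
    eval v (actGL γ f) = eval (Matrix.vecMul v γ) f := by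
  unfold actGL
  have h := eval₂Hom_bind₁ (RingHom.id R) v (fun j => ∑ i : Fin 3, C (γ i j) * X i) f
  change eval v _ = eval _ f at h
  rw [h]
  congr 2
  funext j
  simp [Matrix.vecMul, dotProduct, mul_comm]

lemma pderiv_actGL {R : Type*} [CommRing R] (γ : Matrix (Fin 3) (Fin 3) R)
    (f : MvPolynomial (Fin 3) R) (i : Fin 3) :
    pderiv i (actGL γ f) = ∑ j, C (γ i j) * actGL γ (pderiv j f) := by
  induction f using MvPolynomial.induction_on with
  | C a => simp [actGL]
  | add p q hp hq =>
    simp only [actGL_add, map_add, hp, hq, mul_add, Finset.sum_add_distrib]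
  | mul_X p n hp =>
    have h1 : actGL γ (p * X n) = actGL γ p * ∑ i : Fin 3, C (γ i n) * X i := by
      simp [actGL]
    have h2 : pderiv i (∑ k : Fin 3, C (γ k n) * X k) = C (γ i n) := by
      simp [Derivation.leibniz, pderiv_X, Pi.single_apply]
    have h3 : ∀ j, actGL γ (pderiv j (p * X n))
        = actGL γ p * (if j = n then 1 else 0)
          + (∑ i : Fin 3, C (γ i n) * X i) * actGL γ (pderiv j p) := by
      intro j
      rw [Derivation.leibniz, pderiv_X, smul_eq_mul, smul_eq_mul, Pi.single_apply]
      by_cases h : j = n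
      · simp [h, actGL]
      · simp [h, Ne.symm h, actGL]
    rw [h1, Derivation.leibniz, h2, hp]
    simp only [h3, mul_add, Finset.sum_add_distrib, smul_eq_mul]
    congr 1
    · simp [mul_comm]
    · rw [Finset.mul_sum]
      refine Finset.sum_congr rfl fun j _ => ?_
      ring

lemma hess_actGL {R : Type*} [CommRing R] (γ : Matrix (Fin 3) (Fin 3) R)
    (f : MvPolynomial (Fin 3) R) :
    hess (actGL γ f) = C (γ.det ^ 2) * actGL γ (hess f) := by
  have h : (Matrix.of fun i j => pderiv i (pderiv j (actGL γ f)))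
      = (C : R →+* MvPolynomial (Fin 3) R).mapMatrix γ *
        ((bind₁ (fun j => ∑ i : Fin 3, C (γ i j) * X i)).mapMatrix
          (Matrix.of fun i j => pderiv i (pderiv j f))) *
        ((C : R →+* MvPolynomial (Fin 3) R).mapMatrix γ).transpose := by
    ext1 i j
    simp only [Matrix.of_apply, pderiv_actGL, map_sum, Derivation.leibniz, pderiv_C, mul_zero,
      add_zero, smul_eq_mul, Matrix.mul_apply, Matrix.transpose_apply, RingHom.mapMatrix_apply,
      AlgHom.mapMatrix_apply, Matrix.map_apply]
    refine Finset.sum_congr rfl fun k _ => ?_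
    rw [Finset.mul_sum, Finset.sum_mul]
    refine Finset.sum_congr rfl fun l _ => ?_
    unfold actGL
    ring
  rw [hess, h, Matrix.det_mul, Matrix.det_mul, Matrix.det_transpose, ← RingHom.map_det,
    ← AlgHom.map_det]
  unfold actGL hess
  rw [map_pow]
  ring

lemma exists_cubic_lin {R : Type*} [CommRing R] (u v w : Fin 3 → R) :
    ∃ c : Fin 10 → R, (∑ i, C (u i) * X i) * (∑ i, C (v i) * X i) * (∑ i, C (w i) * X i)
      = cubic c := by
  refine ⟨![u 0 * v 0 * w 0, u 1 * v 1 * w 1, u 2 * v 2 * w 2,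
    u 0 * v 0 * w 1 + u 0 * v 1 * w 0 + u 1 * v 0 * w 0,
    u 0 * v 0 * w 2 + u 0 * v 2 * w 0 + u 2 * v 0 * w 0,
    u 1 * v 1 * w 0 + u 1 * v 0 * w 1 + u 0 * v 1 * w 1,
    u 1 * v 1 * w 2 + u 1 * v 2 * w 1 + u 2 * v 1 * w 1,
    u 2 * v 2 * w 0 + u 2 * v 0 * w 2 + u 0 * v 2 * w 2,
    u 2 * v 2 * w 1 + u 2 * v 1 * w 2 + u 1 * v 2 * w 2,
    u 0 * v 1 * w 2 + u 0 * v 2 * w 1 + u 1 * v 0 * w 2 + u 1 * v 2 * w 0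
      + u 2 * v 0 * w 1 + u 2 * v 1 * w 0], ?_⟩
  rw [cubic_expand]
  simp [Fin.sum_univ_three]
  ring

lemma exists_actGL_cubic {R : Type*} [CommRing R] (γ : Matrix (Fin 3) (Fin 3) R)
    (c : Fin 10 → R) : ∃ d : Fin 10 → R, actGL γ (cubic c) = cubic d := by
  have key : ∀ k : Fin 10, ∃ d : Fin 10 → R,
      actGL γ (∏ i : Fin 3, X i ^ expo k i) = cubic d := by
    intro k
    have aux : ∀ a b e : Fin 3, ∃ d : Fin 10 → R,
        actGL γ (X a * X b * X e) = cubic d := by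
      intro a b e
      obtain ⟨d, hd⟩ := exists_cubic_lin (fun i => γ i a) (fun i => γ i b) (fun i => γ i e)
      exact ⟨d, by rw [← hd]; simp [actGL]⟩
    fin_cases k <;> simp only [Fin.prod_univ_three, expo]
    · convert aux 0 0 0 using 4; simp; ring
    · convert aux 1 1 1 using 4; simp; ring
    · convert aux 2 2 2 using 4; simp; ring
    · convert aux 0 0 1 using 4; simp; ring
    · convert aux 0 0 2 using 4; simp; ring
    · convert aux 1 1 0 using 4; simp; ring
    · convert aux 1 1 2 using 4; simp; ring
    · convert aux 2 2 0 using 4; simp; ring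
    · convert aux 2 2 1 using 4; simp; ring
    · convert aux 0 1 2 using 4; simp
  choose d hd using key
  refine ⟨∑ k, c k • d k, ?_⟩
  have hsum : ∀ s : Finset (Fin 10), cubic (∑ k ∈ s, c k • d k) = ∑ k ∈ s, C (c k) * cubic (d k) := by
    intro s
    induction s using Finset.induction_on with
    | empty => simp [cubic]
    | insert a s ha ih => rw [Finset.sum_insert ha, Finset.sum_insert ha, cubic_add, ih, cubic_smul]
  rw [hsum]
  simp only [← hd, ← actGL_C_mul]
  simp [cubic, actGL]

/-! ### The pencil formula -/

/-- The Hessian pencil formula for a real form `f` with values `I`, `J` of the invariants. -/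
def PF (f : MvPolynomial (Fin 3) ℝ) (I J : ℝ) : Prop :=
  ∀ s t : ℝ, hess (C s * f + C t * hess f) =
    C (192 * I * s ^ 2 * t - 1536 * J * s * t ^ 2 + 12288 * I ^ 2 * t ^ 3) * f
    + C (s ^ 3 - 192 * I * s * t ^ 2 + 512 * J * t ^ 3) * hess f

lemma PF_cubic (c : Fin 10 → ℝ) (I J : ℝ) : PF (cubic c) I J ↔
    ∀ s t : ℝ, ∀ k, hc (s • c + t • hc c) k =
      (192 * I * s ^ 2 * t - 1536 * J * s * t ^ 2 + 12288 * I ^ 2 * t ^ 3) * c k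
      + (s ^ 3 - 192 * I * s * t ^ 2 + 512 * J * t ^ 3) * hc c k := by
  unfold PF
  refine forall_congr' fun s => forall_congr' fun t => ?_
  rw [hess_cubic, ← cubic_smul, ← cubic_smul, ← cubic_smul, ← cubic_smul, ← cubic_add,
    ← cubic_add, hess_cubic]
  constructor
  · intro h k
    have := congrFun (cubic_inj h) k
    simpa using this
  · intro h
    congr 1
    funext k
    simpa using h k

lemma PF_act {f : MvPolynomial (Fin 3) ℝ} {I J : ℝ} (h : PF f I J)
    (γ : Matrix (Fin 3) (Fin 3) ℝ) : PF (actGL γ f) (γ.det ^ 4 * I) (γ.det ^ 6 * J) := by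
  intro s t
  rw [hess_actGL, ← mul_assoc, ← C_mul, ← actGL_C_mul, ← actGL_C_mul, ← actGL_add,
    hess_actGL, h s (t * γ.det ^ 2), actGL_add, actGL_C_mul, actGL_C_mul]
  simp only [map_add, map_sub, map_mul, map_pow, map_ofNat]
  ring

lemma forall_fin10 {p : Fin 10 → Prop} (h0 : p 0) (h1 : p 1) (h2 : p 2) (h3 : p 3) (h4 : p 4)
    (h5 : p 5) (h6 : p 6) (h7 : p 7) (h8 : p 8) (h9 : p 9) : ∀ k, p k := by
  intro k
  fin_cases k <;> assumption

set_option maxHeartbeats 4000000 in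
lemma PF_smooth (a b c d e : ℝ) : PF (cubic ![0, b, e, 0, 1, a, c, 0, d, 0])
    (-3*a^2*e - 3*b*d + c^2)
    (18*a^2*c*e - 27/4*a^2*d^2 - 9*b*c*d + 27*b^2*e + 2*c^3) := by
  rw [PF_cubic]
  intro s t
  apply forall_fin10 <;> simp [hc] <;> ring

set_option maxHeartbeats 4000000 in
lemma PF_sing (a b c d e p q r : ℝ) (hr : r = 2 * (p ^ 2 - 4 * a * q)) :
    PF (cubic ![0, b, e, 0, 0, a, c, q, d, p]) (r ^ 2 / 64) (- r ^ 3 / 256) := by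
  rw [PF_cubic]
  intro s t
  subst hr
  apply forall_fin10 <;> simp [hc] <;> ring

/-! ### Reduction of real cubics -/

/-- Equivalence of real forms under `GL₃(ℝ)`. -/
def Eqv (f g : MvPolynomial (Fin 3) ℝ) : Prop :=
  ∃ γ : Matrix (Fin 3) (Fin 3) ℝ, γ.det ≠ 0 ∧ actGL γ f = g

lemma Eqv.refl (f : MvPolynomial (Fin 3) ℝ) : Eqv f f := ⟨1, by simp, actGL_one f⟩

lemma Eqv.trans {f g h : MvPolynomial (Fin 3) ℝ} (h1 : Eqv f g) (h2 : Eqv g h) : Eqv f h := by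
  obtain ⟨γ, hγ, rfl⟩ := h1
  obtain ⟨δ, hδ, rfl⟩ := h2
  exact ⟨δ * γ, by rw [Matrix.det_mul]; exact mul_ne_zero hδ hγ, (actGL_actGL _ _ _).symm⟩

lemma Eqv.symm {f g : MvPolynomial (Fin 3) ℝ} (h1 : Eqv f g) : Eqv g f := by
  obtain ⟨γ, hγ, rfl⟩ := h1
  have hu : IsUnit γ.det := isUnit_iff_ne_zero.mpr hγ
  refine ⟨γ⁻¹, ?_, ?_⟩
  · exact ((Matrix.isUnit_nonsing_inv_det_iff).mpr hu).ne_zero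
  · rw [actGL_actGL, Matrix.nonsing_inv_mul _ hu, actGL_one]

lemma C_two : (C (2 : ℝ) : MvPolynomial (Fin 3) ℝ) = 2 := map_ofNat _ 2

lemma C_three : (C (3 : ℝ) : MvPolynomial (Fin 3) ℝ) = 3 := map_ofNat _ 3

lemma act_block (c : Fin 10 → ℝ) (α β δ ε : ℝ) :
    actGL !![1, 0, 0; 0, α, δ; 0, β, ε] (cubic c) = cubic ![c 0,
      c 1*α^3+c 2*δ^3+c 6*α^2*δ+c 8*α*δ^2,
      c 1*β^3+c 2*ε^3+c 6*β^2*ε+c 8*β*ε^2,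
      c 3*α+c 4*δ, c 3*β+c 4*ε,
      c 5*α^2+c 7*δ^2+c 9*α*δ,
      3*c 1*α^2*β+3*c 2*δ^2*ε+c 6*(α^2*ε+2*α*β*δ)+c 8*(β*δ^2+2*α*δ*ε),
      c 5*β^2+c 7*ε^2+c 9*β*ε,
      3*c 1*α*β^2+3*c 2*δ*ε^2+c 6*(β^2*δ+2*α*β*ε)+c 8*(α*ε^2+2*β*δ*ε),
      2*c 5*α*β+2*c 7*δ*ε+c 9*(α*ε+β*δ)] := by
  rw [cubic_expand, cubic_expand]
  simp [actGL, Fin.sum_univ_three, map_add, map_mul, map_pow, C_two, C_three]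
  ring

lemma act_shift (c : Fin 10 → ℝ) (l m : ℝ) (h0 : c 0 = 0) (h3 : c 3 = 0) (h4 : c 4 = 1) :
    actGL !![1, 0, 0; l, 1, 0; m, 0, 1] (cubic c) = cubic ![0,
      c 1 + c 5*l, c 2 + m^2 + c 7*m, 0, 1, c 5, c 6 + l^2 + c 5*m + c 9*l,
      c 7 + 2*m, c 8 + 2*l*m+c 9*m+c 7*l, c 9 + 2*l] := by
  rw [cubic_expand, cubic_expand]
  simp [actGL, Fin.sum_univ_three, map_add, map_mul, map_pow, h0, h3, h4, C_two]
  ring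

lemma real_cubic_root (a b c d : ℝ) (ha : a ≠ 0) : ∃ t : ℝ, a*t^3+b*t^2+c*t+d = 0 := by
  have key : ∀ b c d : ℝ, ∃ t : ℝ, t^3+b*t^2+c*t+d = 0 := by
    intro b c d
    have pos : ∀ b c d : ℝ, 0 < (1+|b|+|c|+|d|)^3 + b*(1+|b|+|c|+|d|)^2 + c*(1+|b|+|c|+|d|) + d := by
      intro b c d
      have hb := neg_abs_le b
      have hc := neg_abs_le c
      have hd := neg_abs_le d
      have hb' := abs_nonneg b
      have hc' := abs_nonneg c
      have hd' := abs_nonneg d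
      set M := 1+|b|+|c|+|d| with hM
      have hM1 : 1 ≤ M := by linarith
      have h1 : 0 ≤ (b + |b|) * M^2 := mul_nonneg (by linarith) (by positivity)
      have h2 : 0 ≤ (c + |c|) * M := mul_nonneg (by linarith) (by linarith)
      have h3 : M ≤ M^2 := by nlinarith
      have h4 : 0 ≤ |c| * (M^2 - M) := mul_nonneg hc' (by linarith)
      have h5 : 0 ≤ |d| * (M^2 - 1) := mul_nonneg hd' (by linarith)
      have h6 : M^3 = M^2 + |b| * M^2 + |c| * M^2 + |d| * M^2 := by
        have h7 : M^3 = M * M^2 := by ring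
        rw [h7]
        nth_rewrite 1 [hM]
        ring
      nlinarith
    let g : ℝ → ℝ := fun t => t^3+b*t^2+c*t+d
    have hg : Continuous g := by fun_prop
    have h1 := pos b c d
    have h2 := pos (-b) c (-d)
    rw [abs_neg, abs_neg] at h2
    have := mem_range_of_exists_le_of_exists_ge hg (c := 0)
      ⟨-(1+|b|+|c|+|d|), by simp only [g]; linarith⟩ ⟨1+|b|+|c|+|d|, h1.le⟩
    exact this
  obtain ⟨t, ht⟩ := key (b/a) (c/a) (d/a)
  refine ⟨t, ?_⟩
  field_simp at ht
  linarith

lemma red1 (c : Fin 10 → ℝ) : ∃ d : Fin 10 → ℝ, Eqv (cubic c) (cubic d) ∧ d 0 = 0 := by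
  by_cases h0 : c 0 = 0
  · exact ⟨c, Eqv.refl _, h0⟩
  · obtain ⟨t, ht⟩ := real_cubic_root (c 0) (c 3) (c 5) (c 1) h0
    obtain ⟨d, hd⟩ := exists_actGL_cubic !![t, 1, 0; 1, 0, 0; 0, 0, 1] c
    refine ⟨d, ⟨_, ?_, hd⟩, ?_⟩
    · simp [Matrix.det_fin_three]
    · have h := congrArg (eval ![1, 0, 0]) hd
      rw [eval_actGL, eval_cubic, eval_cubic] at h
      simp [Matrix.vecMul, dotProduct, Fin.sum_univ_three] at h
      linarith

lemma red2 (c : Fin 10 → ℝ) (h0 : c 0 = 0) : ∃ d : Fin 10 → ℝ, Eqv (cubic c) (cubic d) ∧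
    d 0 = 0 ∧ d 3 = 0 ∧ (d 4 = 0 ∨ d 4 = 1) := by
  by_cases h3 : c 3 = 0
  · by_cases h4 : c 4 = 0
    · exact ⟨c, Eqv.refl _, h0, h3, Or.inl h4⟩
    · refine ⟨_, ⟨_, ?_, act_block c 1 0 0 (c 4)⁻¹⟩, ?_, ?_, ?_⟩
      · simp [Matrix.det_fin_three, h4]
      all_goals simp [h0, h3, h4]
  · refine ⟨_, ⟨_, ?_, act_block c (-(c 4) / c 3) (c 3)⁻¹ 1 0⟩, ?_, ?_, ?_⟩
    · simp [Matrix.det_fin_three, h3]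
    · simp [h0]
    · simp; field_simp; ring
    · simp [h3]

lemma red (c : Fin 10 → ℝ) : ∃ d : Fin 10 → ℝ, Eqv (cubic c) (cubic d) ∧
    d 0 = 0 ∧ d 3 = 0 ∧ (d 4 = 0 ∨ (d 4 = 1 ∧ d 7 = 0 ∧ d 9 = 0)) := by
  obtain ⟨c1, e1, h0⟩ := red1 c
  obtain ⟨c2, e2, h0, h3, h4⟩ := red2 c1 h0
  rcases h4 with h4 | h4
  · exact ⟨c2, e1.trans e2, h0, h3, Or.inl h4⟩
  · refine ⟨_, (e1.trans e2).trans ⟨_, ?_, act_shift c2 (-(c2 9)/2) (-(c2 7)/2) h0 h3 h4⟩,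
      ?_, ?_, Or.inr ⟨?_, ?_, ?_⟩⟩
    · simp [Matrix.det_fin_three]
    all_goals simp
    all_goals ring

lemma PF_of_Eqv {f g : MvPolynomial (Fin 3) ℝ} (h : Eqv f g) {I J : ℝ} (hf : PF f I J)
    (hD : 4 * I ^ 3 ≠ J ^ 2) : ∃ I' J', PF g I' J' ∧ 4 * I' ^ 3 ≠ J' ^ 2 := by
  obtain ⟨γ, hγ, rfl⟩ := h
  refine ⟨_, _, PF_act hf γ, ?_⟩
  intro h
  apply hD
  have h12 : γ.det ^ 12 ≠ 0 := pow_ne_zero _ hγ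
  apply mul_left_cancel₀ h12
  linear_combination h

lemma PF_exists (c : Fin 10 → ℝ) : ∃ I J, PF (cubic c) I J := by
  obtain ⟨d, hd, h0, h3, h4⟩ := red c
  have key : ∃ I J, PF (cubic d) I J := by
    rcases h4 with h4 | ⟨h4, h7, h9⟩
    · have : d = ![0, d 1, d 2, 0, 0, d 5, d 6, d 7, d 8, d 9] := by
        funext k; revert k; apply forall_fin10 <;> simp [h0, h3, h4]
      rw [this]
      exact ⟨_, _, PF_sing _ _ _ _ _ _ _ _ rfl⟩
    · have : d = ![0, d 1, d 2, 0, 1, d 5, d 6, 0, d 8, 0] := by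
        funext k; revert k; apply forall_fin10 <;> simp [h0, h3, h4, h7, h9]
      rw [this]
      exact ⟨_, _, PF_smooth _ _ _ _ _⟩
  obtain ⟨γ, _, hγ⟩ := hd.symm
  obtain ⟨I, J, h⟩ := key
  rw [← hγ]
  exact ⟨_, _, PF_act h γ⟩

/-! ### Identification of the invariants -/

lemma hc_map {R S : Type*} [CommRing R] [CommRing S] (φ : R →+* S) (v : Fin 10 → R) (k : Fin 10) :
    φ (hc v k) = hc (fun i => φ (v i)) k := by
  have e : ∀ n : ℕ, [n.AtLeastTwo] → φ (OfNat.ofNat n : R) = OfNat.ofNat n :=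
    fun n _ => map_ofNat φ n
  revert k
  apply forall_fin10 <;> simp [hc, e]

lemma dens (p q : MvPolynomial (Fin 10) ℝ) (h : ∀ c, eval c p * eval c q = 0)
    (w : Fin 10 → ℝ) (hw : eval w p ≠ 0) (c : Fin 10 → ℝ) : eval c q = 0 := by
  have h1 : p * q = 0 := by
    apply MvPolynomial.funext
    intro c
    simpa using h c
  rcases mul_eq_zero.mp h1 with h2 | h2
  · rw [h2] at hw; simp at hw
  · rw [h2]; simp

lemma HH_real {P Q : MvPolynomial (Fin 10) ℚ} (hPQ : IsInvariantPair ℚ P Q) (c : Fin 10 → ℝ)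
    (k : Fin 10) : hc (hc c) k = 12288 * (aeval c P) ^ 2 * c k + 512 * aeval c Q * hc c k := by
  obtain ⟨-, -, h, -⟩ := hPQ
  have e1 : (12288 * C P ^ 2 : MvPolynomial (Fin 3) (MvPolynomial (Fin 10) ℚ))
      = C (12288 * P ^ 2) := by rw [map_mul, map_pow, map_ofNat]
  have e2 : (512 * C Q : MvPolynomial (Fin 3) (MvPolynomial (Fin 10) ℚ))
      = C (512 * Q) := by rw [map_mul, map_ofNat]
  unfold genCubic at h
  rw [hess_cubic, hess_cubic, e1, e2, ← cubic_smul, ← cubic_smul, ← cubic_add] at h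
  have h1 := congrArg (aeval c : MvPolynomial (Fin 10) ℚ →ₐ[ℚ] ℝ) (congrFun (cubic_inj h) k)
  have m1 : ∀ (v : Fin 10 → MvPolynomial (Fin 10) ℚ) k,
      aeval c (hc v k) = hc (fun i => aeval c (v i)) k :=
    fun v k => hc_map ((aeval c : MvPolynomial (Fin 10) ℚ →ₐ[ℚ] ℝ) : _ →+* ℝ) v k
  simp only [Pi.add_apply, Pi.smul_apply, smul_eq_mul, map_add, map_mul, map_pow, m1,
    aeval_X, map_ofNat] at h1
  exact h1

lemma aeval_w {P : MvPolynomial (Fin 10) ℚ} :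
    (aeval (wcoeffs (1 : ℝ) 0) P : ℝ) = ((aeval (wcoeffs (1 : ℚ) 0) P : ℚ) : ℝ) := by
  have : wcoeffs (1 : ℝ) 0 = fun i => algebraMap ℚ ℝ (wcoeffs (1 : ℚ) 0 i) := by
    funext k; revert k
    apply forall_fin10 <;> simp [wcoeffs]
  rw [this]
  exact MvPolynomial.aeval_algebraMap_apply ℝ (wcoeffs (1 : ℚ) 0) P

lemma ident {P Q : MvPolynomial (Fin 10) ℚ} (hPQ : IsInvariantPair ℚ P Q) (c : Fin 10 → ℝ)
    (hc0 : c ≠ 0) {I J : ℝ} (hPF : PF (cubic c) I J) : aeval c P = I ∧ aeval c Q = J := by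
  have hHH := HH_real hPQ
  have hPw : (aeval (wcoeffs (1 : ℝ) 0) P : ℝ) = -3 := by
    rw [aeval_w, (hPQ.2.2.2 1 0).1]; norm_num
  set p : MvPolynomial (Fin 10) ℝ := MvPolynomial.map (algebraMap ℚ ℝ) P with hp
  set q : MvPolynomial (Fin 10) ℝ := MvPolynomial.map (algebraMap ℚ ℝ) Q with hq
  have ep : ∀ c, eval c p = aeval c P := fun c => by rw [hp, eval_map, aeval_def]
  have eq : ∀ c, eval c q = aeval c Q := fun c => by rw [hq, eval_map, aeval_def]
  -- generic vectors
  let V : Fin 10 → MvPolynomial (Fin 10) ℝ := X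
  have eV : ∀ c : Fin 10 → ℝ, (fun i => eval c (V i)) = c := fun c => by funext i; simp [V]
  have eH : ∀ (c : Fin 10 → ℝ) k, eval c (hc V k) = hc c k := fun c k => by
    rw [hc_map (eval c), eV]
  have eA : ∀ (c : Fin 10 → ℝ) k, eval c (hc (V + hc V) k) = hc (c + hc c) k := fun c k => by
    rw [hc_map (eval c)]; congr 1; funext i; simp [V]; exact eH c i
  have eS : ∀ (c : Fin 10 → ℝ) k, eval c (hc (V - hc V) k) = hc (c - hc c) k := fun c k => by
    rw [hc_map (eval c)]; congr 1; funext i; simp [V]; exact eH c i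
  have eHH : ∀ (c : Fin 10 → ℝ) k, eval c (hc (hc V) k) = hc (hc c) k := fun c k => by
    rw [hc_map (eval c)]; congr 1; funext i; exact eH c i
  let E : Fin 10 → MvPolynomial (Fin 10) ℝ := fun j =>
    hc (V + hc V) j - hc (V - hc V) j - 2 * hc (hc V) j
  have eE : ∀ c j, eval c (E j) = hc (c + hc c) j - hc (c - hc c) j - 2 * hc (hc c) j :=
    fun c j => by simp [E, eA, eS, eHH]
  let m : MvPolynomial (Fin 10) ℝ := V 0 * hc V 5 - V 5 * hc V 0
  have em : ∀ c, eval c m = c 0 * hc c 5 - c 5 * hc c 0 := fun c => by simp [m, eH, V]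
  have mw : eval (wcoeffs (1 : ℝ) 0) m ≠ 0 := by
    rw [em]; simp [hc, wcoeffs]
  have Ew : eval (wcoeffs (1 : ℝ) 0) (E 0) = -1152 := by
    rw [eE]; simp [hc, wcoeffs]; norm_num
  -- consequences of the pencil formula
  have pf : ∀ (c : Fin 10 → ℝ) (I J : ℝ), PF (cubic c) I J →
      (∀ j, eval c (E j) = 384 * I * c j) ∧
      (∀ j, 3072 * J * c j = 2 * hc c j - 384 * I * hc c j - hc (c + hc c) j - hc (c - hc c) j) ∧
      eval c m * ((aeval c P) ^ 2 - I ^ 2) = 0 ∧ eval c m * (aeval c Q - J) = 0 := by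
    intro c I J h
    rw [PF_cubic] at h
    have ha : ∀ j, hc (c + hc c) j = _ := fun j => by simpa using h 1 1 j
    have hs : ∀ j, hc (c - hc c) j = _ := fun j => by simpa [← sub_eq_add_neg] using h 1 (-1) j
    have hh : ∀ j, hc (hc c) j = _ := fun j => by simpa using h 0 1 j
    refine ⟨fun j => ?_, fun j => ?_, ?_, ?_⟩
    · rw [eE, ha, hs, hh]; ring
    · rw [ha, hs]; ring
    · have h0 := (hHH c 0).symm.trans (hh 0)
      have h5 := (hHH c 5).symm.trans (hh 5)
      rw [em]
      linear_combination (hc c 5 * h0 - hc c 0 * h5) / 12288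
    · have h0 := (hHH c 0).symm.trans (hh 0)
      have h5 := (hHH c 5).symm.trans (hh 5)
      rw [em]
      linear_combination (c 0 * h5 - c 5 * h0) / 512
  -- step 1
  have s1 : ∀ c, eval c ((384 * p * V 0 + E 0 : MvPolynomial (Fin 10) ℝ) )
      * eval c ((384 * p * V 0 - E 0 : MvPolynomial (Fin 10) ℝ) ) = 0 := by
    intro c
    rw [← map_mul]
    refine dens m _ (fun c => ?_) _ mw c
    obtain ⟨I, J, h⟩ := PF_exists c
    obtain ⟨h1, -, h3, -⟩ := pf c I J h
    simp only [map_mul, map_add, map_sub, h1, ep, V, eval_X, map_ofNat]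
    linear_combination 384 ^ 2 * (c 0) ^ 2 * h3
  have s2 : ∀ c, eval c ((384 * p * V 0 - E 0 : MvPolynomial (Fin 10) ℝ) ) = 0 := by
    refine dens _ _ s1 (wcoeffs (1 : ℝ) 0) ?_
    rw [map_add, Ew]
    simp only [map_mul, ep, hPw, V, eval_X, map_ofNat]
    simp [wcoeffs]; norm_num
  have s3 : ∀ c j, eval c ((384 * p * V j - E j : MvPolynomial (Fin 10) ℝ) ) = 0 := by
    intro c j
    refine dens (V 0) _ (fun c => ?_) (wcoeffs (1 : ℝ) 0) (by simp [V, wcoeffs]) c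
    obtain ⟨I, J, h⟩ := PF_exists c
    obtain ⟨h1, -, -, -⟩ := pf c I J h
    have h2 := s2 c
    simp only [map_mul, map_add, map_sub, h1, ep, V, eval_X, map_ofNat] at h2 ⊢
    linear_combination c j * h2
  have s4 : ∀ c : Fin 10 → ℝ, c ≠ 0 → ∀ I J, PF (cubic c) I J → aeval c P = I := by
    intro c hcn I J h
    obtain ⟨j, hj⟩ := Function.ne_iff.mp hcn
    obtain ⟨h1, -, -, -⟩ := pf c I J h
    have h2 := s3 c j
    simp only [map_mul, map_add, map_sub, h1, ep, V, eval_X, map_ofNat] at h2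
    apply mul_right_cancel₀ hj
    linear_combination h2 / 384
  have s5 : ∀ c j, eval c ((3072 * q * V j - (2 * hc V j - 384 * p * hc V j
      - hc (V + hc V) j - hc (V - hc V) j) : MvPolynomial (Fin 10) ℝ) ) = 0 := by
    intro c j
    refine dens m _ (fun c => ?_) _ mw c
    obtain ⟨I, J, h⟩ := PF_exists c
    obtain ⟨-, h2, -, h4⟩ := pf c I J h
    by_cases hcn : c = 0
    · have : eval c m = 0 := by rw [em, hcn]; simp
      rw [this, zero_mul]
    · have h5 := s4 c hcn I J h
      simp only [map_mul, map_add, map_sub, eH, eA, eS, ep, eq, V, eval_X, map_ofNat, h5]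
      linear_combination 3072 * c j * h4 + eval c m * h2 j
  refine ⟨s4 c hc0 I J hPF, ?_⟩
  obtain ⟨j, hj⟩ := Function.ne_iff.mp hc0
  obtain ⟨-, h2, -, -⟩ := pf c I J hPF
  have h3 := s5 c j
  simp only [map_mul, map_add, map_sub, eH, eA, eS, ep, eq, V, eval_X, map_ofNat,
    s4 c hc0 I J hPF] at h3
  apply mul_right_cancel₀ hj
  linear_combination (h3 - h2 j) / 3072

/-! ### The real triangle in the Hessian pencil -/

lemma num {I J κ : ℝ} (h : ∀ s t : ℝ, κ * (s + κ * t) ^ 3 =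
    (192 * I * s ^ 2 * t - 1536 * J * s * t ^ 2 + 12288 * I ^ 2 * t ^ 3)
      + κ * (s ^ 3 - 192 * I * s * t ^ 2 + 512 * J * t ^ 3)) : 4 * I ^ 3 = J ^ 2 := by
  have h0 := h 0 1
  have h1 := h 1 1
  have h2 := h (-1) 1
  have hI : I = κ ^ 2 / 64 := by linear_combination (-h1 - h2 + 2 * h0) / 384
  have hJ : J = - κ ^ 3 / 256 := by
    subst hI
    linear_combination (h1 - h2) / 3072
  subst hI hJ
  ring

lemma hc_smul (s : ℝ) (c : Fin 10 → ℝ) : hc (s • c) = s ^ 3 • hc c := by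
  funext k; revert k
  apply forall_fin10 <;> simp [hc] <;> ring

lemma dep {c : Fin 10 → ℝ} (hc0 : c ≠ 0) {I J κ : ℝ} (h : PF (cubic c) I J)
    (hk : hc c = κ • c) : 4 * I ^ 3 = J ^ 2 := by
  obtain ⟨k, hck⟩ := Function.ne_iff.mp hc0
  rw [PF_cubic] at h
  apply num (κ := κ)
  intro s t
  have := h s t k
  rw [hk, smul_smul, ← add_smul, hc_smul, hk] at this
  simp only [Pi.smul_apply, smul_eq_mul] at this
  apply mul_right_cancel₀ hck
  linear_combination this

lemma quartic_root {I J : ℝ} (hD : 4 * I ^ 3 ≠ J ^ 2) :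
    ∃ s : ℝ, s ^ 4 - 6 * I * s ^ 2 + 4 * J * s - 3 * I ^ 2 = 0 ∧ 0 < s ^ 3 - 3 * I * s + J := by
  let φ : ℝ → ℝ := fun s => s ^ 4 - 6 * I * s ^ 2 + 4 * J * s - 3 * I ^ 2
  have hφ : Continuous φ := by fun_prop
  let S : Set ℝ := {s | φ s ≤ 0}
  have hcl : IsClosed S := isClosed_le hφ continuous_const
  have hne : S.Nonempty := ⟨0, by simp only [S, φ, Set.mem_setOf_eq]; nlinarith [sq_nonneg I]⟩
  have hbd : BddAbove S := by
    refine ⟨1 + 6 * |I| + 4 * |J| + 3 * I ^ 2, ?_⟩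
    intro s hs
    by_contra hlt
    push Not at hlt
    have hI := le_abs_self I
    have hJ := neg_abs_le J
    have hI0 := abs_nonneg I
    have hJ0 := abs_nonneg J
    have hI2 := sq_nonneg I
    have hs1 : 1 < s := by linarith
    have hs' : s ^ 4 - 6 * I * s ^ 2 + 4 * J * s - 3 * I ^ 2 ≤ 0 := hs
    have a1 : 0 ≤ (|I| - I) * s ^ 2 := mul_nonneg (by linarith) (by positivity)
    have a2 : 0 ≤ (|J| + J) * s := mul_nonneg (by linarith) (by linarith)
    have a3 : 0 < (s - (1 + 6 * |I| + 4 * |J| + 3 * I ^ 2)) * s ^ 3 :=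
      mul_pos (by linarith) (by positivity)
    have b1 : s ^ 2 ≤ s ^ 3 := pow_le_pow_right₀ hs1.le (by norm_num)
    have b2 : s ≤ s ^ 3 := le_self_pow₀ hs1.le (by norm_num)
    have b3 : 1 ≤ s ^ 3 := one_le_pow₀ hs1.le
    have c1 := mul_nonneg hI0 (sub_nonneg.mpr b1)
    have c2 := mul_nonneg hJ0 (sub_nonneg.mpr b2)
    have c3 := mul_nonneg hI2 (sub_nonneg.mpr b3)
    nlinarith
  set s := sSup S with hs
  have hsS : φ s ≤ 0 := hcl.csSup_mem hne hbd
  have hgt : ∀ h : ℝ, 0 < h → 0 < φ (s + h) := by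
    intro h hh
    by_contra hle
    push Not at hle
    have := le_csSup hbd (show s + h ∈ S from hle)
    linarith
  have lim : ∀ g : ℝ → ℝ, Continuous g → (∀ h, 0 < h → 0 < g h) → 0 ≤ g 0 := by
    intro g hg h
    have hc : IsClosed {h | 0 ≤ g h} := isClosed_le continuous_const hg
    have hsub : Set.Ioi (0 : ℝ) ⊆ {h | 0 ≤ g h} := fun x hx => (h x hx).le
    have := closure_minimal hsub hc
    rw [closure_Ioi] at this
    exact this (Set.self_mem_Ici)
  have h0 : φ s = 0 := by
    apply le_antisymm hsS
    have := lim (fun h => φ (s + h)) (by fun_prop) hgt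
    simpa using this
  have h0' : s ^ 4 - 6 * I * s ^ 2 + 4 * J * s - 3 * I ^ 2 = 0 := h0
  have h1 : 0 ≤ s ^ 3 - 3 * I * s + J := by
    have := lim (fun h => 4 * (s ^ 3 - 3 * I * s + J) + h * (6 * s ^ 2 - 6 * I) + 4 * s * h ^ 2
      + h ^ 3) (by fun_prop) (by
        intro h hh
        have e : φ (s + h) = h * (4 * (s ^ 3 - 3 * I * s + J) + h * (6 * s ^ 2 - 6 * I)
          + 4 * s * h ^ 2 + h ^ 3) := by
          simp only [φ]
          linear_combination h0'
        have := hgt h hh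
        rw [e] at this
        exact (pos_iff_pos_of_mul_pos this).mp hh)
    simp at this
    linarith
  refine ⟨s, h0', lt_of_le_of_ne h1 ?_⟩
  intro h
  apply hD
  have q1 : I * s ^ 2 - J * s + I ^ 2 = 0 := by linear_combination (-h0' - s * h) / 3
  have q2 : J * s ^ 2 - 4 * I ^ 2 * s + I * J = 0 := by linear_combination - s * q1 - I * h
  have q3 : s * (4 * I ^ 3 - J ^ 2) = 0 := by linear_combination J * q1 - I * q2
  rcases mul_eq_zero.mp q3 with h3 | h3
  · rw [h3] at h q1
    have hJ : J = 0 := by linear_combination -h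
    have hI : I = 0 := by simpa using q1
    rw [hI, hJ]; norm_num
  · linarith

lemma exists_tri {c : Fin 10 → ℝ} (hc0 : c ≠ 0) {I J : ℝ} (h : PF (cubic c) I J)
    (hD : 4 * I ^ 3 ≠ J ^ 2) : ∃ s : ℝ, 0 < s ^ 3 - 3 * I * s + J ∧
    (8 * s) • c + hc c ≠ 0 ∧
    hc ((8 * s) • c + hc c) = (512 * (s ^ 3 - 3 * I * s + J)) • ((8 * s) • c + hc c) := by
  obtain ⟨s, h0, h1⟩ := quartic_root hD
  refine ⟨s, h1, ?_, ?_⟩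
  · intro h2
    apply hD
    apply dep hc0 h (κ := -(8 * s))
    rw [neg_smul]
    exact eq_neg_of_add_eq_zero_right h2
  · rw [PF_cubic] at h
    funext k
    have := h (8 * s) 1 k
    rw [one_smul] at this
    rw [this]
    simp only [Pi.smul_apply, smul_eq_mul, Pi.add_apply]
    linear_combination (-4096) * c k * h0

/-- Coefficient vector of `x³·a + y³·b + z³·c + d·xyz`. -/
def fam {R : Type*} [CommRing R] (a b c d : R) : Fin 10 → R := ![a, b, c, 0, 0, 0, 0, 0, 0, d]

lemma cubic_zero : cubic (0 : Fin 10 → ℝ) = 0 := by simp [cubic]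

lemma ne_zero_of_Eqv {c d : Fin 10 → ℝ} (h : Eqv (cubic c) (cubic d)) (hc0 : c ≠ 0) : d ≠ 0 := by
  rintro rfl
  apply hc0
  obtain ⟨γ, -, hγ⟩ := h.symm
  apply cubic_inj
  rw [cubic_zero] at hγ ⊢
  rw [← hγ]
  simp [actGL]

lemma eig_of_Eqv {c d : Fin 10 → ℝ} (h : Eqv (cubic c) (cubic d)) {M : ℝ} (hM : 0 < M)
    (hc0 : hc c = M • c) : ∃ M' : ℝ, 0 < M' ∧ hc d = M' • d := by
  obtain ⟨γ, hγ, e⟩ := h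
  refine ⟨γ.det ^ 2 * M, by positivity, ?_⟩
  apply cubic_inj
  rw [← hess_cubic, ← e, hess_actGL, hess_cubic, hc0, cubic_smul, cubic_smul, actGL_C_mul, e,
    ← mul_assoc, C_mul]

lemma tri_smooth {d : Fin 10 → ℝ} {M : ℝ} (hM : 0 < M) (h : hc d = M • d)
    (h0 : d 0 = 0) (h3 : d 3 = 0) (h4 : d 4 = 1) (h7 : d 7 = 0) (h9 : d 9 = 0) :
    Eqv (cubic d) (cubic (fam 0 0 0 1)) := by
  have k := congrFun h
  have k0 := k 0
  have k3 := k 3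
  have k4 := k 4
  have k2 := k 2
  simp [hc, h0, h3, h4, h7, h9] at k0 k3 k4 k2
  have hneg : 0 < - d 6 := by linarith
  set r := Real.sqrt (- d 6) with hr
  have hr2 : r ^ 2 = - d 6 := Real.sq_sqrt hneg.le
  have hr0 : r ≠ 0 := (Real.sqrt_pos.mpr hneg).ne'
  obtain ⟨m, hm⟩ : ∃ m, 2 * r * m = - d 8 := ⟨- d 8 / (2 * r), by field_simp⟩
  have hd2 : d 2 = - m ^ 2 := by
    have h62 : d 6 ≠ 0 := by linarith
    apply mul_left_cancel₀ h62
    rw [← k4] at k2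
    have : d 8 ^ 2 = - 4 * d 6 * m ^ 2 := by
      linear_combination (d 8 - 2 * r * m) * hm + 4 * m ^ 2 * hr2
    linear_combination (k2 + 8 * this) / 32
  have hd6 : d 6 = - r ^ 2 := by linarith
  have hd8 : d 8 = - (2 * r * m) := by linarith
  refine Eqv.symm ⟨!![0, 1, 1; 0, -r, r; 1, -m, m], ?_, ?_⟩
  · simp [Matrix.det_fin_three]
    intro h
    apply hr0
    linarith
  · rw [cubic_expand, cubic_expand, h0, h3, h4, h7, h9, k0, k3, hd2, hd6, hd8]
    simp [actGL, Fin.sum_univ_three, fam, C_two]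
    ring

lemma tri_sing' {d : Fin 10 → ℝ} (hd : d ≠ 0) {M : ℝ} (hM : 0 < M) (h : hc d = M • d)
    (h0 : d 0 = 0) (h3 : d 3 = 0) (h4 : d 4 = 0) (h5 : d 5 = 0) (h7 : d 7 = 0) :
    Eqv (cubic d) (cubic (fam 0 0 0 1)) := by
  have k := congrFun h
  have h9 : d 9 ≠ 0 := by
    intro h9
    apply hd
    have : hc d = 0 := by
      funext k; revert k
      apply forall_fin10 <;> simp [hc, h0, h3, h4, h5, h7, h9]
    rw [this] at h
    rcases smul_eq_zero.mp h.symm with h | h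
    · exact absurd h hM.ne'
    · exact h
  have k1 := k 1
  have k2 := k 2
  simp [hc, h0, h3, h4, h5, h7] at k1 k2
  have hp : 0 < M + 6 * d 9 ^ 2 := by positivity
  have h1 : d 1 = 0 := by
    apply (mul_eq_zero.mp (show (M + 6 * d 9 ^ 2) * d 1 = 0 by linarith)).resolve_left hp.ne'
  have h2 : d 2 = 0 := by
    apply (mul_eq_zero.mp (show (M + 6 * d 9 ^ 2) * d 2 = 0 by linarith)).resolve_left hp.ne'
  refine Eqv.symm ⟨!![d 9, 0, 0; d 6, 1, 0; d 8, 0, 1], ?_, ?_⟩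
  · simp [Matrix.det_fin_three, h9]
  · rw [cubic_expand, cubic_expand, h0, h1, h2, h3, h4, h5, h7]
    simp [actGL, Fin.sum_univ_three, fam]
    ring

lemma tri_sing {d : Fin 10 → ℝ} (hd : d ≠ 0) {M : ℝ} (hM : 0 < M) (h : hc d = M • d)
    (h0 : d 0 = 0) (h3 : d 3 = 0) (h4 : d 4 = 0) :
    Eqv (cubic d) (cubic (fam 0 0 0 1)) := by
  have k := congrFun h
  have hdisc : 0 < d 9 ^ 2 - 4 * d 5 * d 7 := by
    have k5 := k 5
    have k7 := k 7
    have k9 := k 9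
    simp [hc, h0, h3, h4] at k5 k7 k9
    have e : M = 2 * (d 9 ^ 2 - 4 * d 5 * d 7) := by
      by_contra hne
      have hne' : M - 2 * (d 9 ^ 2 - 4 * d 5 * d 7) ≠ 0 := sub_ne_zero.mpr hne
      have e5 : d 5 = 0 := (mul_eq_zero.mp (show _ * d 5 = 0 by
        linear_combination -k5)).resolve_left hne'
      have e7 : d 7 = 0 := (mul_eq_zero.mp (show _ * d 7 = 0 by
        linear_combination -k7)).resolve_left hne'
      have e9 : d 9 = 0 := (mul_eq_zero.mp (show _ * d 9 = 0 by
        linear_combination -k9)).resolve_left hne'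
      apply hd
      have : hc d = 0 := by
        funext k; revert k
        apply forall_fin10 <;> simp [hc, h0, h3, h4, e5, e7, e9]
      rw [this] at h
      rcases smul_eq_zero.mp h.symm with h | h
      · exact absurd h hM.ne'
      · exact h
    linarith
  have split : ∃ α β δ ε : ℝ, α * ε - β * δ ≠ 0 ∧
      d 5*α^2+d 7*δ^2+d 9*α*δ = 0 ∧ d 5*β^2+d 7*ε^2+d 9*β*ε = 0 := by
    by_cases h5 : d 5 = 0
    · refine ⟨1, - d 7, 0, d 9, ?_, ?_, ?_⟩
      · intro h9
        have : d 9 = 0 := by linarith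
        rw [this, h5] at hdisc
        simp at hdisc
      · rw [h5]; ring
      · rw [h5]; ring
    · set r := Real.sqrt (d 9 ^ 2 - 4 * d 5 * d 7) with hr
      have hr2 : r ^ 2 = _ := Real.sq_sqrt hdisc.le
      have hr0 : r ≠ 0 := (Real.sqrt_pos.mpr hdisc).ne'
      refine ⟨- d 9 + r, - d 9 - r, 2 * d 5, 2 * d 5, ?_, ?_, ?_⟩
      · have : (- d 9 + r) * (2 * d 5) - (- d 9 - r) * (2 * d 5) = 4 * r * d 5 := by ring
        rw [this]
        exact mul_ne_zero (mul_ne_zero (by norm_num) hr0) h5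
      · linear_combination d 5 * hr2
      · linear_combination d 5 * hr2
  obtain ⟨α, β, δ, ε, hdet, e5, e7⟩ := split
  have ev : Eqv (cubic d) _ := ⟨_, ?_, act_block d α β δ ε⟩
  · obtain ⟨M', hM', hh⟩ := eig_of_Eqv ev hM h
    refine ev.trans (tri_sing' (ne_zero_of_Eqv ev hd) hM' hh ?_ ?_ ?_ ?_ ?_)
    · simp [h0]
    · simp [h3, h4]
    · simp [h3, h4]
    · simpa using e5
    · simpa using e7
  · simp [Matrix.det_fin_three]
    intro h
    apply hdet
    linarith

lemma tri {d : Fin 10 → ℝ} (hd : d ≠ 0) {M : ℝ} (hM : 0 < M) (h : hc d = M • d) :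
    Eqv (cubic d) (cubic (fam 0 0 0 1)) := by
  obtain ⟨e, ev, h0, h3, h4⟩ := red d
  obtain ⟨M', hM', hh⟩ := eig_of_Eqv ev hM h
  refine ev.trans ?_
  rcases h4 with h4 | ⟨h4, h7, h9⟩
  · exact tri_sing (ne_zero_of_Eqv ev hd) hM' hh h0 h3 h4
  · exact tri_smooth hM' hh h0 h3 h4 h7 h9

/-! ### Reduction to the Hesse normal form -/

lemma six_zero {c : Fin 10 → ℝ} {I J s ν : ℝ} (h : PF (cubic c) I J) (hν : ν ≠ 0)
    (hm : 0 < s ^ 3 - 3 * I * s + J) (hh : hc c = ν • fam 0 0 0 1 - (8 * s) • c) :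
    c = fam (c 0) (c 1) (c 2) (c 9) := by
  rw [PF_cubic] at h
  have hp : 2 * ν ^ 2 + 1536 * (s ^ 3 - 3 * I * s + J) ≠ 0 := by positivity
  have key : ∀ k : Fin 10, (fam (0 : ℝ) 0 0 1) k = 0 → ∀ ε : ℝ,
      hc (ε • c + ν • fam 0 0 0 1) k = (192 * I * (8 * s + ε) ^ 2 - 1536 * J * (8 * s + ε)
        + 12288 * I ^ 2 - 8 * s * ((8 * s + ε) ^ 3 - 192 * I * (8 * s + ε) + 512 * J)) * c k := by
    intro k hk ε
    have h1 := h (8 * s + ε) 1 k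
    have e : (8 * s + ε) • c + (1 : ℝ) • hc c = ε • c + ν • fam 0 0 0 1 := by
      rw [hh, one_smul, add_smul]; abel
    rw [e, hh] at h1
    simp only [Pi.sub_apply, Pi.smul_apply, smul_eq_mul, hk] at h1
    rw [h1]; ring
  have z : ∀ k : Fin 10, (fam (0 : ℝ) 0 0 1) k = 0 →
      (8 * (hc ((1 : ℝ) • c + ν • fam 0 0 0 1) k - hc ((-1 : ℝ) • c + ν • fam 0 0 0 1) k)
      - (hc ((2 : ℝ) • c + ν • fam 0 0 0 1) k - hc ((-2 : ℝ) • c + ν • fam 0 0 0 1) k)) / 12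
      = 2 * ν ^ 2 * c k → c k = 0 := by
    intro k hk h1
    apply (mul_eq_zero.mp (show _ * c k = 0 from ?_)).resolve_left hp
    rw [key k hk, key k hk, key k hk, key k hk] at h1
    linear_combination -h1
  funext k; revert k
  apply forall_fin10
  · simp [fam]
  · simp [fam]
  · simp [fam]
  · refine z 3 (by simp [fam]) ?_
    simp [hc, fam]; ring
  · refine z 4 (by simp [fam]) ?_
    simp [hc, fam]; ring
  · refine z 5 (by simp [fam]) ?_
    simp [hc, fam]; ring
  · refine z 6 (by simp [fam]) ?_
    simp [hc, fam]; ring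
  · refine z 7 (by simp [fam]) ?_
    simp [hc, fam]; ring
  · refine z 8 (by simp [fam]) ?_
    simp [hc, fam]; ring
  · simp [fam]

lemma to_fam {c : Fin 10 → ℝ} (hc0 : c ≠ 0) {I J : ℝ} (h : PF (cubic c) I J)
    (hD : 4 * I ^ 3 ≠ J ^ 2) : ∃ a b e d : ℝ, Eqv (cubic c) (cubic (fam a b e d)) := by
  obtain ⟨s, hm, hne, hg⟩ := exists_tri hc0 h hD
  obtain ⟨γ, hγ, hγg⟩ := tri hne (by positivity) hg
  obtain ⟨c1, e1⟩ := exists_actGL_cubic γ c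
  refine ⟨c1 0, c1 1, c1 2, c1 9, γ, hγ, e1.trans ?_⟩
  have hPF := PF_act h γ
  rw [e1] at hPF
  congr 1
  refine six_zero (s := γ.det ^ 2 * s) (ν := γ.det ^ 2) hPF (pow_ne_zero _ hγ) ?_ ?_
  · have : (γ.det ^ 2 * s) ^ 3 - 3 * (γ.det ^ 4 * I) * (γ.det ^ 2 * s) + γ.det ^ 6 * J
        = γ.det ^ 6 * (s ^ 3 - 3 * I * s + J) := by ring
    rw [this]
    positivity
  · rw [cubic_add, cubic_smul, ← hess_cubic, actGL_add, actGL_C_mul, e1] at hγg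
    have e2 := hess_actGL γ (cubic c)
    rw [e1, hess_cubic] at e2
    rw [eq_sub_iff_add_eq]
    apply cubic_inj
    rw [cubic_add, cubic_smul, cubic_smul, e2, ← hγg]
    simp only [map_mul]
    ring

lemma hc_fam (a b e d : ℝ) : hc (fam a b e d) =
    fam (-6 * a * d ^ 2) (-6 * b * d ^ 2) (-6 * e * d ^ 2) (216 * (a * b * e) + 2 * d ^ 3) := by
  funext k; revert k
  apply forall_fin10 <;> simp [hc, fam]
  ring

lemma fam_prod {a b e d I J : ℝ} (hne : fam a b e d ≠ 0) (h : PF (cubic (fam a b e d)) I J)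
    (hD : 4 * I ^ 3 ≠ J ^ 2) : a * b * e ≠ 0 := by
  intro h0
  apply hD
  by_cases hd : d = 0
  · refine dep (κ := 0) hne h ?_
    rw [hc_fam, h0, hd, zero_smul]
    funext k; revert k
    apply forall_fin10 <;> simp [fam]
  · apply num (κ := 2 * d ^ 2)
    intro s t
    rw [PF_cubic] at h
    have h1 := h s t 9
    rw [hc_fam, h0] at h1
    have e : s • fam a b e d + t • fam (-6 * a * d ^ 2) (-6 * b * d ^ 2) (-6 * e * d ^ 2)
        (216 * 0 + 2 * d ^ 3) = fam (a * (s - 6 * t * d ^ 2)) (b * (s - 6 * t * d ^ 2))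
        (e * (s - 6 * t * d ^ 2)) (s * d + 2 * d ^ 3 * t) := by
      funext k; revert k
      apply forall_fin10 <;> simp [fam] <;> ring
    rw [e, hc_fam] at h1
    simp [fam] at h1
    apply mul_right_cancel₀ hd
    linear_combination h1 - 216 * (s - 6 * t * d ^ 2) ^ 3 * h0

lemma cube_root {a : ℝ} (ha : a ≠ 0) : ∃ t : ℝ, t ≠ 0 ∧ t ^ 3 = a := by
  obtain ⟨t, ht⟩ := real_cubic_root 1 0 0 (-a) one_ne_zero
  have : t ^ 3 = a := by linarith
  refine ⟨t, ?_, this⟩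
  rintro rfl
  apply ha
  rw [← this]; norm_num

lemma fam_scale {a b e : ℝ} (d : ℝ) (h : a * b * e ≠ 0) :
    ∃ d', Eqv (cubic (fam a b e d)) (cubic (fam 1 1 1 d')) := by
  obtain ⟨r, hr, rfl⟩ := cube_root (left_ne_zero_of_mul (left_ne_zero_of_mul h))
  obtain ⟨s, hs, rfl⟩ := cube_root (right_ne_zero_of_mul (left_ne_zero_of_mul h))
  obtain ⟨t, ht, rfl⟩ := cube_root (right_ne_zero_of_mul h)
  obtain ⟨d', rfl⟩ : ∃ d', d = d' * (r * s * t) := ⟨d / (r * s * t), by field_simp⟩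
  refine ⟨d', Eqv.symm ⟨!![r, 0, 0; 0, s, 0; 0, 0, t], ?_, ?_⟩⟩
  · simp [Matrix.det_fin_three, hr, hs, ht]
  · rw [cubic_expand, cubic_expand]
    simp [actGL, Fin.sum_univ_three, fam]
    ring

lemma normal {c : Fin 10 → ℝ} (hc0 : c ≠ 0) {I J : ℝ} (h : PF (cubic c) I J)
    (hD : 4 * I ^ 3 ≠ J ^ 2) : ∃ d : ℝ, Eqv (cubic c) (cubic (fam 1 1 1 d)) := by
  obtain ⟨a, b, e, d, ev⟩ := to_fam hc0 h hD
  obtain ⟨I', J', h', hD'⟩ := PF_of_Eqv ev h hD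
  obtain ⟨d', ev'⟩ := fam_scale d (fam_prod (ne_zero_of_Eqv ev hc0) h' hD')
  exact ⟨d', ev.trans ev'⟩

/-! ### The stabilizer of the Hesse normal form -/

lemma PF_unique {c : Fin 10 → ℝ} (hc0 : c ≠ 0) {I J I' J' : ℝ} (h : PF (cubic c) I J)
    (h' : PF (cubic c) I' J') (hD : 4 * I ^ 3 ≠ J ^ 2) : I' = I ∧ J' = J := by
  have key : ∀ s t : ℝ, s ^ 3 - 192 * I' * s * t ^ 2 + 512 * J' * t ^ 3
      = s ^ 3 - 192 * I * s * t ^ 2 + 512 * J * t ^ 3 := by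
    intro s t
    by_contra hne
    apply hD
    have hne' := sub_ne_zero.mpr hne
    set A := 192 * I * s ^ 2 * t - 1536 * J * s * t ^ 2 + 12288 * I ^ 2 * t ^ 3 with hA
    set A' := 192 * I' * s ^ 2 * t - 1536 * J' * s * t ^ 2 + 12288 * I' ^ 2 * t ^ 3 with hA'
    set B := s ^ 3 - 192 * I * s * t ^ 2 + 512 * J * t ^ 3 with hB
    set B' := s ^ 3 - 192 * I' * s * t ^ 2 + 512 * J' * t ^ 3 with hB'
    refine dep hc0 h (κ := (A - A') / (B' - B)) ?_
    rw [PF_cubic] at h h'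
    funext k
    have h1 := (h s t k).symm.trans (h' s t k)
    rw [← hA, ← hA', ← hB, ← hB'] at h1
    simp only [Pi.smul_apply, smul_eq_mul]
    field_simp
    linear_combination -h1
  have k1 := key 1 1
  have k2 := key 1 (-1)
  constructor
  · linear_combination (k1 + k2) / (-384)
  · linear_combination (k1 - k2) / 1024

lemma det_one {c : Fin 10 → ℝ} (hc0 : c ≠ 0) {I J : ℝ} (h : PF (cubic c) I J)
    (hD : 4 * I ^ 3 ≠ J ^ 2) {γ : Matrix (Fin 3) (Fin 3) ℝ} (hγ : 0 < γ.det)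
    (hf : actGL γ (cubic c) = cubic c) : γ.det = 1 := by
  have h1 := PF_act h γ
  rw [hf] at h1
  obtain ⟨hI, hJ⟩ := PF_unique hc0 h h1 hD
  by_cases hI0 : I = 0
  · have hJ0 : J ≠ 0 := by
      rintro rfl
      apply hD
      rw [hI0]; norm_num
    have : γ.det ^ 6 = 1 := mul_right_cancel₀ hJ0 (by rw [hJ, one_mul])
    exact (pow_eq_one_iff_of_nonneg hγ.le (by norm_num)).mp this
  · have : γ.det ^ 4 = 1 := mul_right_cancel₀ hI0 (by rw [hI, one_mul])
    exact (pow_eq_one_iff_of_nonneg hγ.le (by norm_num)).mp this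

lemma fam_comb (d : ℝ) : hc (fam 1 1 1 d) =
    (-6 * d ^ 2) • fam 1 1 1 d + (216 + 8 * d ^ 3) • fam 0 0 0 1 := by
  rw [hc_fam]
  funext k; revert k
  apply forall_fin10 <;> simp [fam]
  ring

lemma fam_ne (d : ℝ) : fam 1 1 1 d ≠ 0 := by
  intro h
  have := congrFun h 0
  simp [fam] at this

lemma fix_xyz {d I J : ℝ} (h : PF (cubic (fam 1 1 1 d)) I J)
    (hD : 4 * I ^ 3 ≠ J ^ 2) {γ : Matrix (Fin 3) (Fin 3) ℝ} (hγ : 0 < γ.det)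
    (hf : actGL γ (cubic (fam 1 1 1 d)) = cubic (fam 1 1 1 d)) :
    actGL γ (cubic (fam 0 0 0 1)) = cubic (fam 0 0 0 1) := by
  have hd1 := det_one (fam_ne d) h hD hγ hf
  have hne : (216 + 8 * d ^ 3) ≠ 0 := by
    intro h0
    apply hD
    refine dep (fam_ne d) h (κ := -6 * d ^ 2) ?_
    rw [fam_comb, h0, zero_smul, add_zero]
  have h1 := hess_actGL γ (cubic (fam 1 1 1 d))
  rw [hf, hd1, hess_cubic, fam_comb, cubic_add, cubic_smul, cubic_smul, actGL_add, actGL_C_mul,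
    actGL_C_mul, hf, one_pow, C_1, one_mul] at h1
  have h2 := add_left_cancel h1
  exact (mul_left_cancel₀ (fun h0 => hne (C_eq_zero.mp h0)) h2).symm

lemma act_xyz (γ : Matrix (Fin 3) (Fin 3) ℝ) : actGL γ (cubic (fam 0 0 0 1)) = cubic
    ![γ 0 0 * γ 0 1 * γ 0 2, γ 1 0 * γ 1 1 * γ 1 2, γ 2 0 * γ 2 1 * γ 2 2,
      γ 0 0 * γ 0 1 * γ 1 2 + γ 0 0 * γ 1 1 * γ 0 2 + γ 1 0 * γ 0 1 * γ 0 2,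
      γ 0 0 * γ 0 1 * γ 2 2 + γ 0 0 * γ 2 1 * γ 0 2 + γ 2 0 * γ 0 1 * γ 0 2,
      γ 1 0 * γ 1 1 * γ 0 2 + γ 1 0 * γ 0 1 * γ 1 2 + γ 0 0 * γ 1 1 * γ 1 2,
      γ 1 0 * γ 1 1 * γ 2 2 + γ 1 0 * γ 2 1 * γ 1 2 + γ 2 0 * γ 1 1 * γ 1 2,
      γ 2 0 * γ 2 1 * γ 0 2 + γ 2 0 * γ 0 1 * γ 2 2 + γ 0 0 * γ 2 1 * γ 2 2,
      γ 2 0 * γ 2 1 * γ 1 2 + γ 2 0 * γ 1 1 * γ 2 2 + γ 1 0 * γ 2 1 * γ 2 2,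
      γ 0 0 * γ 1 1 * γ 2 2 + γ 0 0 * γ 2 1 * γ 1 2 + γ 1 0 * γ 0 1 * γ 2 2
        + γ 1 0 * γ 2 1 * γ 0 2 + γ 2 0 * γ 0 1 * γ 1 2 + γ 2 0 * γ 1 1 * γ 0 2] := by
  rw [cubic_expand, cubic_expand]
  simp [actGL, Fin.sum_univ_three, fam]
  ring

lemma cube_sum {d : ℝ} {γ : Matrix (Fin 3) (Fin 3) ℝ} (i : Fin 3)
    (hf : actGL γ (cubic (fam 1 1 1 d)) = cubic (fam 1 1 1 d))
    (hp : γ i 0 * γ i 1 * γ i 2 = 0) : γ i 0 ^ 3 + γ i 1 ^ 3 + γ i 2 ^ 3 = 1 := by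
  have h := congrArg (eval (Pi.single i 1)) hf
  rw [eval_actGL, eval_cubic, eval_cubic] at h
  simp only [fam, Matrix.single_one_vecMul, Matrix.row_apply] at h
  fin_cases i <;> simp [Pi.single_apply] at h hp ⊢
  all_goals
    rcases hp with (hp | hp) | hp <;> simp [hp] at h ⊢ <;> linarith

lemma row_cases {u0 u1 u2 v0 v1 v2 w0 w1 w2 : ℝ} (hp : u0 * u1 * u2 = 0)
    (hs : u0 ^ 3 + u1 ^ 3 + u2 ^ 3 = 1)
    (hv : u0 * u1 * v2 + u0 * v1 * u2 + v0 * u1 * u2 = 0)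
    (hw : u0 * u1 * w2 + u0 * w1 * u2 + w0 * u1 * u2 = 0)
    (h0 : ¬ (u0 = 0 ∧ v0 = 0 ∧ w0 = 0)) (h1 : ¬ (u1 = 0 ∧ v1 = 0 ∧ w1 = 0))
    (h2 : ¬ (u2 = 0 ∧ v2 = 0 ∧ w2 = 0)) :
    (u0 = 1 ∧ u1 = 0 ∧ u2 = 0) ∨ (u0 = 0 ∧ u1 = 1 ∧ u2 = 0) ∨ (u0 = 0 ∧ u1 = 0 ∧ u2 = 1) := by
  have cb : ∀ t : ℝ, t ^ 3 = 1 → t = 1 := by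
    intro t ht
    have h : (t - 1) * (t ^ 2 + t + 1) = 0 := by linear_combination ht
    rcases mul_eq_zero.mp h with h | h
    · linarith
    · nlinarith [sq_nonneg (t + 1 / 2)]
  by_cases z0 : u0 = 0 <;> by_cases z1 : u1 = 0 <;> by_cases z2 : u2 = 0 <;>
    simp [z0, z1, z2] at hp hs hv hw h0 h1 h2 ⊢
  · exact cb _ hs
  · exact cb _ hs
  · exact absurd hw (h0 hv)
  · exact cb _ hs
  · exact absurd hw (h1 hv)
  · exact absurd hw (h2 hv)

lemma stab_fam {d I J : ℝ} (h : PF (cubic (fam 1 1 1 d)) I J) (hD : 4 * I ^ 3 ≠ J ^ 2) :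
    {γ : Matrix (Fin 3) (Fin 3) ℝ | 0 < γ.det ∧
      actGL γ (cubic (fam 1 1 1 d)) = cubic (fam 1 1 1 d)}.ncard = 3 := by
  rw [Set.ncard_eq_three]
  refine ⟨!![1, 0, 0; 0, 1, 0; 0, 0, 1], !![0, 1, 0; 0, 0, 1; 1, 0, 0],
    !![0, 0, 1; 1, 0, 0; 0, 1, 0], ?_, ?_, ?_, ?_⟩
  · intro h
    have := congrFun (congrFun h 0) 0
    simp at this
  · intro h
    have := congrFun (congrFun h 0) 0
    simp at this
  · intro h
    have := congrFun (congrFun h 0) 1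
    simp at this
  ext γ
  simp only [Set.mem_setOf_eq, Set.mem_insert_iff, Set.mem_singleton_iff]
  constructor
  · rintro ⟨hγ, hf⟩
    have hx := fix_xyz h hD hγ hf
    rw [act_xyz] at hx
    have k := congrFun (cubic_inj hx)
    have k0 := k 0
    have k1 := k 1
    have k2 := k 2
    have k3 := k 3
    have k4 := k 4
    have k5 := k 5
    have k6 := k 6
    have k7 := k 7
    have k8 := k 8
    simp [fam, -mul_eq_zero] at k0 k1 k2 k3 k4 k5 k6 k7 k8
    have s0 := cube_sum 0 hf k0
    have s1 := cube_sum 1 hf k1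
    have s2 := cube_sum 2 hf k2
    have col : ∀ j, ¬ (γ 0 j = 0 ∧ γ 1 j = 0 ∧ γ 2 j = 0) := by
      rintro j ⟨a, b, c⟩
      apply hγ.ne'
      apply Matrix.det_eq_zero_of_column_eq_zero j
      intro i
      fin_cases i <;> assumption
    have r0 := row_cases k0 s0 k3 k4 (col 0) (col 1) (col 2)
    have r1 := row_cases (v0 := γ 0 0) (v1 := γ 0 1) (v2 := γ 0 2) k1 s1
      (by linarith) k6 (fun h => col 0 ⟨h.2.1, h.1, h.2.2⟩)
      (fun h => col 1 ⟨h.2.1, h.1, h.2.2⟩) (fun h => col 2 ⟨h.2.1, h.1, h.2.2⟩)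
    have r2 := row_cases (v0 := γ 0 0) (v1 := γ 0 1) (v2 := γ 0 2)
      (w0 := γ 1 0) (w1 := γ 1 1) (w2 := γ 1 2) k2 s2
      (by linarith) (by linarith) (fun h => col 0 ⟨h.2.1, h.2.2, h.1⟩)
      (fun h => col 1 ⟨h.2.1, h.2.2, h.1⟩) (fun h => col 2 ⟨h.2.1, h.2.2, h.1⟩)
    rw [Matrix.det_fin_three] at hγ
    rw [Matrix.eta_fin_three γ]
    rcases r0 with ⟨a0, a1, a2⟩ | ⟨a0, a1, a2⟩ | ⟨a0, a1, a2⟩ <;>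
    rcases r1 with ⟨b0, b1, b2⟩ | ⟨b0, b1, b2⟩ | ⟨b0, b1, b2⟩ <;>
    rcases r2 with ⟨c0, c1, c2⟩ | ⟨c0, c1, c2⟩ | ⟨c0, c1, c2⟩ <;>
    rw [a0, a1, a2, b0, b1, b2, c0, c1, c2] at hγ ⊢ <;>
    first
      | (exfalso; norm_num at hγ; done)
      | (left; rfl)
      | (right; left; rfl)
      | (right; right; rfl)
  · rintro (rfl | rfl | rfl)
    all_goals
      refine ⟨by simp [Matrix.det_fin_three], ?_⟩
      rw [cubic_expand]
      simp [actGL, Fin.sum_univ_three, fam]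
      try ring

lemma stab_Eqv {f g : MvPolynomial (Fin 3) ℝ} (h : Eqv f g) :
    {γ : Matrix (Fin 3) (Fin 3) ℝ | 0 < γ.det ∧ actGL γ f = f}.ncard =
    {γ : Matrix (Fin 3) (Fin 3) ℝ | 0 < γ.det ∧ actGL γ g = g}.ncard := by
  obtain ⟨γ, hγ, rfl⟩ := h
  have hu : IsUnit γ.det := isUnit_iff_ne_zero.mpr hγ
  have m1 : γ * γ⁻¹ = 1 := Matrix.mul_nonsing_inv _ hu
  have m2 : γ⁻¹ * γ = 1 := Matrix.nonsing_inv_mul _ hu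
  have hd : γ.det * γ⁻¹.det = 1 := by rw [← Matrix.det_mul, m1, Matrix.det_one]
  have hinj : Function.Injective (fun δ : Matrix (Fin 3) (Fin 3) ℝ => γ * δ * γ⁻¹) := by
    intro a b hab
    have h1 : γ * a * γ⁻¹ = γ * b * γ⁻¹ := hab
    calc a = γ⁻¹ * γ * a * (γ⁻¹ * γ) := by rw [m2, one_mul, mul_one]
      _ = γ⁻¹ * (γ * a * γ⁻¹) * γ := by simp only [mul_assoc]
      _ = γ⁻¹ * (γ * b * γ⁻¹) * γ := by rw [h1]
      _ = γ⁻¹ * γ * b * (γ⁻¹ * γ) := by simp only [mul_assoc]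
      _ = b := by rw [m2, one_mul, mul_one]
  rw [← Set.ncard_image_of_injective _ hinj]
  congr 1
  ext δ
  simp only [Set.mem_image, Set.mem_setOf_eq]
  constructor
  · rintro ⟨ε, ⟨h1, h2⟩, rfl⟩
    constructor
    · rw [Matrix.det_mul, Matrix.det_mul]
      have : γ.det * ε.det * γ⁻¹.det = ε.det := by linear_combination ε.det * hd
      rw [this]; exact h1
    · rw [actGL_actGL, mul_assoc, m2, mul_one, ← actGL_actGL, h2]
  · rintro ⟨h1, h2⟩
    refine ⟨γ⁻¹ * δ * γ, ⟨?_, ?_⟩, ?_⟩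
    · rw [Matrix.det_mul, Matrix.det_mul]
      have : γ⁻¹.det * δ.det * γ.det = δ.det := by linear_combination δ.det * hd
      rw [this]; exact h1
    · rw [actGL_actGL] at h2
      rw [mul_assoc, ← actGL_actGL, h2, actGL_actGL, m2, actGL_one]
    · calc γ * (γ⁻¹ * δ * γ) * γ⁻¹ = γ * γ⁻¹ * δ * (γ * γ⁻¹) := by simp only [mul_assoc]
        _ = δ := by rw [m1, one_mul, mul_one]

/-- Let `f` be a ternary cubic form over `ℝ` with `Δ(f) ≠ 0`. Then the stabilizer of `f`
in `GL₃⁺(ℝ)`, i.e., the set of `γ ∈ GL₃(ℝ)` with `det(γ) > 0` and `γ·f = f`, has exactly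
3 elements. -/
theorem stmt5 (P Q : MvPolynomial (Fin 10) ℚ) (hPQ : IsInvariantPair ℚ P Q)
    (c : Fin 10 → ℝ)
    (hΔ : (4 * (aeval c P : ℝ) ^ 3 - (aeval c Q : ℝ) ^ 2) / 27 ≠ 0) :
    {γ : Matrix (Fin 3) (Fin 3) ℝ | 0 < γ.det ∧ actGL γ (cubic c) = cubic c}.ncard = 3 := by
  have hD : 4 * (aeval c P : ℝ) ^ 3 ≠ (aeval c Q : ℝ) ^ 2 := by
    intro h
    apply hΔ
    rw [h, sub_self, zero_div]
  have hc0 : c ≠ 0 := by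
    rintro rfl
    apply hD
    have e : ∀ (p : MvPolynomial (Fin 10) ℚ) (n : ℕ), n ≠ 0 → p.IsHomogeneous n →
        (aeval (0 : Fin 10 → ℝ) p : ℝ) = 0 := by
      intro p n hn hp
      have : constantCoeff p = 0 := hp.coeff_eq_zero (by simpa using hn.symm)
      rw [aeval_zero, this, map_zero]
    rw [e P 4 (by norm_num) hPQ.1, e Q 6 (by norm_num) hPQ.2.1]
    norm_num
  obtain ⟨I, J, h⟩ := PF_exists c
  obtain ⟨hI, hJ⟩ := ident hPQ c hc0 h
  rw [hI, hJ] at hD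
  obtain ⟨d, ev⟩ := normal hc0 h hD
  obtain ⟨I', J', h', hD'⟩ := PF_of_Eqv ev h hD
  rw [stab_Eqv ev]
  exact stab_fam h' hD'
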